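/- arXiv:1207.5004 — 14 statements merged into one kernel-verified Lean document; each statement's English description precedes it below -/
import Mathlib

section
/- If P₁ and P₂ are path sets in A^ℕ, then P₁ ∩ P₂ is a path set. -/
/-- The path set presented by the pointed graph with edge relation `E` and
distinguished vertex `v0`: all label sequences of infinite walks from `v0`. -/
def pathSet {A V : Type*} (E : V → A → V → Prop) (v0 : V) : Set (ℕ → A) :=
  {x | ∃ p : ℕ → V, p 0 = v0 ∧ ∀ n, E (p n) (x n) (p (n + 1))}

/-- A set `P ⊆ A^ℕ` is a path set if it is presented by some pointed graph
with a finite vertex type. -/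
def IsPathSet {A : Type*} [Fintype A] (P : Set (ℕ → A)) : Prop :=
  ∃ (V : Type) (_ : Fintype V) (E : V → A → V → Prop) (v0 : V), P = pathSet E v0

/-- The fibre product of two pointed graphs presents the intersection of their path sets. -/
theorem pathSet_inter {A V W : Type*} (E : V → A → V → Prop) (F : W → A → W → Prop)
    (v0 : V) (w0 : W) :
    pathSet E v0 ∩ pathSet F w0 =
      pathSet (fun (u : V × W) a u' => E u.1 a u'.1 ∧ F u.2 a u'.2) (v0, w0) := by
  ext x
  constructor
  · rintro ⟨⟨p, hp0, hp⟩, q, hq0, hq⟩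
    exact ⟨fun n => (p n, q n), Prod.ext hp0 hq0, fun n => ⟨hp n, hq n⟩⟩
  · rintro ⟨p, hp0, hp⟩
    exact ⟨⟨fun n => (p n).1, congrArg Prod.fst hp0, fun n => (hp n).1⟩,
      fun n => (p n).2, congrArg Prod.snd hp0, fun n => (hp n).2⟩

/-- The intersection of two path sets is a path set. -/
theorem isPathSet_inter {A : Type} [Fintype A] (P₁ P₂ : Set (ℕ → A))
    (h₁ : IsPathSet P₁) (h₂ : IsPathSet P₂) : IsPathSet (P₁ ∩ P₂) := by
  obtain ⟨V, _, E, v0, rfl⟩ := h₁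
  obtain ⟨W, _, F, w0, rfl⟩ := h₂
  exact ⟨V × W, inferInstance, _, _, pathSet_inter E F v0 w0⟩
end

section
/- If P₁ and P₂ are path sets in A^ℕ, then P₁ ∪ P₂ is a path set. -/
/-- The edge relation on the disjoint union of a family of pointed graphs together with a fresh
vertex `none`, which has the outgoing edges of every distinguished vertex. -/
def sigmaEdge {A ι : Type*} {V : ι → Type*} (E : ∀ i, V i → A → V i → Prop) (v0 : ∀ i, V i)
    (u : Option (Σ i, V i)) (a : A) (u' : Option (Σ i, V i)) : Prop :=
  ∃ (i : ι) (v w : V i), (u = none ∧ v = v0 i ∨ u = some ⟨i, v⟩) ∧ u' = some ⟨i, w⟩ ∧ E i v a w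

theorem pathSet_sigmaEdge {A ι : Type*} {V : ι → Type*} (E : ∀ i, V i → A → V i → Prop)
    (v0 : ∀ i, V i) : pathSet (sigmaEdge E v0) none = ⋃ i, pathSet (E i) (v0 i) := by
  ext x
  rw [Set.mem_iUnion]
  constructor
  · rintro ⟨q, hq0, hq⟩
    obtain ⟨i, -, w, -, hw, -⟩ := hq 0
    have stays : ∀ n, ∃ w : V i, q (n + 1) = some ⟨i, w⟩ := by
      intro n
      induction n with
      | zero => exact ⟨w, hw⟩
      | succ n ih =>
        obtain ⟨w, hw⟩ := ih
        obtain ⟨j, v, w', hv, hw', -⟩ := hq (n + 1)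
        rw [hw] at hv
        obtain ⟨h, -⟩ | h := hv
        · cases h
        · cases h
          exact ⟨w', hw'⟩
    choose r hr using stays
    refine ⟨i, fun n => Nat.casesOn n (v0 i) r, rfl, fun n => ?_⟩
    obtain ⟨j, v, w', hv, hw', hE⟩ := hq n
    rw [hr n] at hw'
    cases hw'
    cases n with
    | zero =>
      obtain ⟨-, rfl⟩ | h := hv
      · exact hE
      · rw [hq0] at h
        cases h
    | succ n =>
      rw [hr n] at hv
      obtain ⟨h, -⟩ | h := hv
      · cases h
      · cases h
        exact hE
  · rintro ⟨i, p, hp0, hp⟩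
    refine ⟨fun n => Nat.casesOn n none fun n => some ⟨i, p (n + 1)⟩, rfl, fun n => ?_⟩
    refine ⟨i, p n, p (n + 1), ?_, rfl, hp n⟩
    cases n with
    | zero => exact Or.inl ⟨rfl, hp0⟩
    | succ n => exact Or.inr rfl

theorem isPathSet_iUnion {A : Type*} [Fintype A] {ι : Type} [Fintype ι] (P : ι → Set (ℕ → A))
    (h : ∀ i, IsPathSet (P i)) : IsPathSet (⋃ i, P i) := by
  choose V hV E v0 hP using h
  refine ⟨Option (Σ i, V i), inferInstance, sigmaEdge E v0, none, ?_⟩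
  rw [pathSet_sigmaEdge]
  exact Set.iUnion_congr hP

/-- The union of two path sets is a path set. -/
theorem isPathSet_union {A : Type} [Fintype A] (P₁ P₂ : Set (ℕ → A))
    (h₁ : IsPathSet P₁) (h₂ : IsPathSet P₂) : IsPathSet (P₁ ∪ P₂) := by
  rw [Set.union_eq_iUnion]
  exact isPathSet_iUnion _ (Bool.rec h₂ h₁)
end

section
/- For any path set P ⊆ A^ℕ, the image σ '' P under the one-sided shift is again a path set. -/
/-- The one-sided shift map `σ`. -/
def shift {A : Type*} (x : ℕ → A) : ℕ → A := fun n => x (n + 1)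

/-- Edge relation on `Option V` whose new vertex `none` has the outgoing edges of all
successors of `v0`. -/
def successorEdge {A V : Type*} (E : V → A → V → Prop) (v0 : V) : Option V → A → Option V → Prop
  | _, _, none => False
  | none, a, some w => ∃ b v, E v0 b v ∧ E v a w
  | some v, a, some w => E v a w

theorem shift_image_pathSet {A V : Type*} (E : V → A → V → Prop) (v0 : V) :
    shift '' pathSet E v0 = pathSet (successorEdge E v0) none := by
  ext x
  constructor
  · rintro ⟨y, ⟨p, rfl, hp⟩, rfl⟩
    refine ⟨fun n => Nat.casesOn n none fun k => some (p (k + 2)), rfl, ?_⟩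
    rintro (_ | n)
    · exact ⟨y 0, p 1, hp 0, hp 1⟩
    · exact hp (n + 2)
  · rintro ⟨p, hp0, hp⟩
    have hsome : ∀ n, ∃ w, p (n + 1) = some w := by
      intro n
      have h := hp n
      cases hq : p (n + 1) with
      | none => simp [hq, successorEdge] at h
      | some w => exact ⟨w, rfl⟩
    choose q hq using hsome
    obtain ⟨b, v, hb, hv⟩ : ∃ b v, E v0 b v ∧ E v (x 0) (q 0) := by
      have h := hp 0
      rwa [hp0, hq 0] at h
    refine ⟨fun n => Nat.casesOn n b x,
      ⟨fun n => Nat.casesOn n v0 fun k => Nat.casesOn k v q, rfl, ?_⟩, rfl⟩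
    rintro (_ | _ | n)
    · exact hb
    · exact hv
    · have h := hp (n + 1)
      rwa [hq n, hq (n + 1)] at h

/-- The image of a path set under the one-sided shift is a path set. -/
theorem isPathSet_shift_image {A : Type} [Fintype A] (P : Set (ℕ → A))
    (hP : IsPathSet P) : IsPathSet (shift '' P) := by
  obtain ⟨V, _, E, v0, rfl⟩ := hP
  exact ⟨Option V, inferInstance, successorEdge E v0, none, shift_image_pathSet E v0⟩
end

section
/- For any path set P ⊆ A^ℕ, the one-sided shift closure ⋃_{j ∈ ℕ} σ^j '' P (the union over all j of the images of P under the j-fold iterate of the shift) is a path set. -/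
theorem shift_mem_pathSet {A V : Type*} {E : V → A → V → Prop} {u : V} {x : ℕ → A}
    (hx : x ∈ pathSet E u) : ∃ v, E u (x 0) v ∧ shift x ∈ pathSet E v := by
  obtain ⟨p, rfl, hp⟩ := hx
  exact ⟨p 1, hp 0, fun n => p (n + 1), rfl, fun n => hp (n + 1)⟩

theorem mem_pathSet_of_shift_mem {A V : Type*} {E : V → A → V → Prop} {u v : V} {x : ℕ → A}
    (h : E u (x 0) v) (hx : shift x ∈ pathSet E v) : x ∈ pathSet E u := by
  obtain ⟨p, rfl, hp⟩ := hx
  refine ⟨fun n => Nat.casesOn n u p, rfl, fun n => ?_⟩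
  cases n with
  | zero => exact h
  | succ n => exact hp n

/-- The shift closure of a path set is the union of the path sets of all reachable vertices. -/
theorem iUnion_shift_image_pathSet {A V : Type*} (E : V → A → V → Prop) (v0 : V) :
    (⋃ j : ℕ, (shift^[j]) '' pathSet E v0) =
      ⋃ u ∈ {u | Relation.ReflTransGen (fun u v => ∃ a, E u a v) v0 u}, pathSet E u := by
  ext x
  simp only [Set.mem_iUnion, Set.mem_image, Set.mem_ofPred_eq, exists_prop]
  constructor
  · rintro ⟨j, y, hy, rfl⟩
    induction j with
    | zero => exact ⟨v0, .refl, hy⟩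
    | succ j ih =>
      obtain ⟨u, hu, hyu⟩ := ih
      obtain ⟨v, huv, hyv⟩ := shift_mem_pathSet hyu
      rw [Function.iterate_succ_apply']
      exact ⟨v, hu.tail ⟨_, huv⟩, hyv⟩
  · rintro ⟨u, hu, hx⟩
    induction hu using Relation.ReflTransGen.head_induction_on with
    | refl => exact ⟨0, x, hx, rfl⟩
    | head h _ ih =>
      obtain ⟨a, ha⟩ := h
      obtain ⟨j, y, hy, rfl⟩ := ih
      exact ⟨j + 1, fun n => Nat.casesOn n a y, mem_pathSet_of_shift_mem ha hy, rfl⟩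

/-- A union of path sets presented by one finite graph is a path set: add a fresh
distinguished vertex with a copy of every edge leaving one of the chosen vertices. -/
theorem isPathSet_biUnion_pathSet {A : Type*} [Fintype A] {V : Type} [Fintype V]
    (E : V → A → V → Prop) (S : Set V) : IsPathSet (⋃ u ∈ S, pathSet E u) := by
  let E' : Option V → A → Option V → Prop := fun s a t =>
    ∃ u v, t = some v ∧ E u a v ∧ (s = some u ∨ s = none ∧ u ∈ S)
  have pathSet_some (v : V) : pathSet E' (some v) = pathSet E v := by
    ext x
    constructor
    · rintro ⟨p, hp0, hp⟩
      have hsome : ∀ n, ∃ w, p n = some w := by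
        rintro (_ | n)
        · exact ⟨v, hp0⟩
        · obtain ⟨_, w, hw, _⟩ := hp n
          exact ⟨w, hw⟩
      choose q hq using hsome
      refine ⟨q, Option.some.inj ((hq 0).symm.trans hp0), fun n => ?_⟩
      obtain ⟨u, w, hw, hE, hs⟩ := hp n
      simp_all
    · rintro ⟨p, rfl, hp⟩
      exact ⟨fun n => some (p n), rfl, fun n => ⟨_, _, rfl, hp n, .inl rfl⟩⟩
  refine ⟨Option V, inferInstance, E', none, ?_⟩
  ext x
  simp only [Set.mem_iUnion, exists_prop]
  constructor
  · rintro ⟨u, hu, hx⟩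
    obtain ⟨v, huv, hxv⟩ := shift_mem_pathSet hx
    rw [← pathSet_some] at hxv
    exact mem_pathSet_of_shift_mem ⟨u, v, rfl, huv, .inr ⟨rfl, hu⟩⟩ hxv
  · intro hx
    obtain ⟨_, ⟨u, v, rfl, huv, hs⟩, hxv⟩ := shift_mem_pathSet hx
    rw [pathSet_some] at hxv
    obtain hs | ⟨_, hu⟩ := hs
    · cases hs
    · exact ⟨u, hu, mem_pathSet_of_shift_mem huv hxv⟩

/-- The one-sided shift closure of a path set is a path set. -/
theorem isPathSet_shift_closure {A : Type} [Fintype A] (P : Set (ℕ → A))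
    (hP : IsPathSet P) : IsPathSet (⋃ j : ℕ, (shift^[j]) '' P) := by
  obtain ⟨V, _, E, v0, rfl⟩ := hP
  rw [iUnion_shift_image_pathSet]
  exact isPathSet_biUnion_pathSet E _
end

section
/- Every path set P ⊆ A^ℕ has a presentation (V, E, v0) that is right-resolving and reachable: there exist a finite type V, a labeled-edge relation E : V → A → V → Prop that is right-resolving, and a vertex v0 : V such that X_{(V,E)}(v0) = P and every vertex of V can be reached from v0 by a finite directed path. -/
/-- A labeled graph is right-resolving if from each vertex, for each label,
there is at most one exit edge with that label. -/
def RightResolving {A V : Type*} (E : V → A → V → Prop) : Prop :=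
  ∀ v a w w', E v a w → E v a w' → w = w'

/-- Kőnig's lemma for labeled walks in a finite graph: a sequence all of whose
finite prefixes label walks from `v0` labels an infinite walk from `v0`. -/
theorem mem_pathSet_of_forall_prefix {A V : Type*} [Finite V] {E : V → A → V → Prop}
    {v0 : V} {x : ℕ → A}
    (h : ∀ n, ∃ p : ℕ → V, p 0 = v0 ∧ ∀ i < n, E (p i) (x i) (p (i + 1))) :
    x ∈ pathSet E v0 := by
  let _ : TopologicalSpace V := ⊥
  have : DiscreteTopology V := ⟨rfl⟩
  let C : ℕ → Set (ℕ → V) := fun n => {p | p 0 = v0 ∧ ∀ i < n, E (p i) (x i) (p (i + 1))}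
  have hC : ∀ n, IsClosed (C n) := by
    intro n
    have hEq : C n = (fun p : ℕ → V => p 0) ⁻¹' {v0} ∩
        ⋂ i, ⋂ (_ : i < n), (fun p : ℕ → V => (p i, p (i + 1))) ⁻¹' {q | E q.1 (x i) q.2} := by
      ext p
      simp [C]
    rw [hEq]
    refine IsClosed.inter ((isClosed_discrete _).preimage (by fun_prop)) ?_
    exact isClosed_iInter fun i => isClosed_iInter fun _ =>
      (isClosed_discrete _).preimage (by fun_prop)
  obtain ⟨p, hp⟩ := IsCompact.nonempty_iInter_of_sequence_nonempty_isCompact_isClosed C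
    (fun n p hp => ⟨hp.1, fun i hi => hp.2 i (by omega)⟩) h (hC 0).isCompact hC
  rw [Set.mem_iInter] at hp
  exact ⟨p, (hp 0).1, fun n => (hp (n + 1)).2 n n.lt_succ_self⟩

/-- The set of `a`-successors of the vertices in `S`. -/
def successors {A V : Type*} (E : V → A → V → Prop) (S : Set V) (a : A) : Set V :=
  {w | ∃ v ∈ S, E v a w}

/-- The edge relation of the subset construction, on nonempty successor sets. -/
def subsetEdge {A V : Type*} (E : V → A → V → Prop) (S : Set V) (a : A) (T : Set V) : Prop :=
  T = successors E S a ∧ T.Nonempty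

theorem rightResolving_subsetEdge {A V : Type*} (E : V → A → V → Prop) :
    RightResolving (subsetEdge E) :=
  fun _ _ _ _ h h' => h.1.trans h'.1.symm

/-- Every vertex of the state reached after `n` steps of the subset construction
is the endpoint of a walk with the same labels. -/
theorem exists_walk_of_mem_subset_walk {A V : Type*} {E : V → A → V → Prop} {v0 : V}
    {x : ℕ → A} {S : ℕ → Set V} (h0 : S 0 = {v0})
    (hS : ∀ n, subsetEdge E (S n) (x n) (S (n + 1))) (n : ℕ) :
    ∀ v ∈ S n, ∃ p : ℕ → V, p 0 = v0 ∧ (∀ i < n, E (p i) (x i) (p (i + 1))) ∧ p n = v := by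
  induction n with
  | zero =>
    intro v hv
    rw [h0] at hv
    exact ⟨fun _ => v0, rfl, by simp, hv.symm⟩
  | succ n ih =>
    intro w hw
    rw [(hS n).1] at hw
    obtain ⟨v, hv, hvw⟩ := hw
    obtain ⟨p, hp0, hp, rfl⟩ := ih v hv
    refine ⟨fun i => if i ≤ n then p i else w, by simpa using hp0, fun i hi => ?_, by simp⟩
    rcases Nat.lt_succ_iff_lt_or_eq.mp hi with hi | rfl
    · simpa [hi.le, Nat.succ_le_of_lt hi] using hp i hi
    · simpa using hvw

theorem pathSet_subsetEdge {A V : Type*} [Finite V] (E : V → A → V → Prop) (v0 : V) :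
    pathSet (subsetEdge E) {v0} = pathSet E v0 := by
  ext x
  constructor
  · rintro ⟨S, h0, hS⟩
    refine mem_pathSet_of_forall_prefix fun n => ?_
    have hne : (S n).Nonempty := by
      cases n with
      | zero => simp [h0]
      | succ n => exact (hS n).2
    obtain ⟨v, hv⟩ := hne
    obtain ⟨p, hp0, hp, -⟩ := exists_walk_of_mem_subset_walk h0 hS n v hv
    exact ⟨p, hp0, hp⟩
  · rintro ⟨p, h0, hp⟩
    let S : ℕ → Set V := fun n => Nat.rec {v0} (fun n T => successors E T (x n)) n
    have hmem : ∀ n, p n ∈ S n := by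
      intro n
      induction n with
      | zero => exact h0
      | succ n ih => exact ⟨p n, ih, hp n⟩
    exact ⟨S, rfl, fun n => ⟨rfl, p (n + 1), hmem (n + 1)⟩⟩

/-- `w` can be reached from `v0` by a finite directed path. -/
abbrev Reachable {A V : Type*} (E : V → A → V → Prop) (v0 w : V) : Prop :=
  Relation.ReflTransGen (fun u u' => ∃ a, E u a u') v0 w

/-- The restriction of a labeled graph to the vertices reachable from `v0`. -/
def reachableEdge {A V : Type*} (E : V → A → V → Prop) (v0 : V)
    (u : {w // Reachable E v0 w}) (a : A) (u' : {w // Reachable E v0 w}) : Prop :=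
  E u a u'

theorem RightResolving.reachableEdge {A V : Type*} {E : V → A → V → Prop}
    (h : RightResolving E) (v0 : V) : RightResolving (reachableEdge E v0) :=
  fun _ _ _ _ hw hw' => Subtype.ext (h _ _ _ _ hw hw')

theorem pathSet_reachableEdge {A V : Type*} (E : V → A → V → Prop) (v0 : V) :
    pathSet (reachableEdge E v0) ⟨v0, Relation.ReflTransGen.refl⟩ = pathSet E v0 := by
  ext x
  constructor
  · rintro ⟨p, h0, hp⟩
    exact ⟨fun n => p n, congrArg Subtype.val h0, hp⟩
  · rintro ⟨p, h0, hp⟩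
    have hr : ∀ n, Reachable E v0 (p n) := by
      intro n
      induction n with
      | zero => exact h0 ▸ Relation.ReflTransGen.refl
      | succ n ih => exact ih.tail ⟨x n, hp n⟩
    exact ⟨fun n => ⟨p n, hr n⟩, Subtype.ext h0, hp⟩

theorem reachable_reachableEdge {A V : Type*} (E : V → A → V → Prop) (v0 : V)
    (w : {w // Reachable E v0 w}) :
    Reachable (reachableEdge E v0) ⟨v0, Relation.ReflTransGen.refl⟩ w := by
  obtain ⟨w, hw⟩ := w
  induction hw with
  | refl => exact Relation.ReflTransGen.refl
  | tail _ huw ih =>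
    obtain ⟨a, ha⟩ := huw
    exact ih.tail ⟨a, ha⟩

/-- Every path set has a right-resolving presentation in which every vertex is
reachable from the distinguished vertex by a finite directed path. -/
theorem exists_rightResolving_reachable_presentation {A : Type} [Fintype A]
    (P : Set (ℕ → A)) (hP : IsPathSet P) :
    ∃ (V : Type) (_ : Fintype V) (E : V → A → V → Prop) (v0 : V),
      RightResolving E ∧ pathSet E v0 = P ∧
      ∀ w : V, Relation.ReflTransGen (fun u u' => ∃ a, E u a u') v0 w := by
  obtain ⟨V, _, E, v0, rfl⟩ := hP
  exact ⟨_, Fintype.ofFinite {S // Reachable (subsetEdge E) {v0} S},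
    reachableEdge (subsetEdge E) {v0}, ⟨{v0}, Relation.ReflTransGen.refl⟩,
    (rightResolving_subsetEdge E).reachableEdge _,
    (pathSet_reachableEdge _ _).trans (pathSet_subsetEdge E v0),
    reachable_reachableEdge _ _⟩
end

section
/- Let P ⊆ A^ℕ be a path set with σ '' P = P. Then for every m ≥ 1 and every j ≥ 0, the decimated set satisfies ψ_{j,m} '' P = ψ_{0,m} '' P (so all decimations with the same modulus m coincide), and each decimated set is shift-invariant: σ '' (ψ_{j,m} '' P) = ψ_{j,m} '' P. -/
/-- The decimation map `ψ_{j,m}`, extracting the digits in the arithmetic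
progression `j, j+m, j+2m, …`. -/
def decimate {A : Type*} (j m : ℕ) (x : ℕ → A) : ℕ → A := fun n => x (j + n * m)

theorem decimate_shift {A : Type*} (j m : ℕ) (x : ℕ → A) :
    decimate j m (shift x) = decimate (j + 1) m x := by
  funext n
  exact congrArg x (by ring)

theorem shift_decimate {A : Type*} (j m : ℕ) (x : ℕ → A) :
    shift (decimate j m x) = decimate (j + m) m x := by
  funext n
  exact congrArg x (by ring)

theorem image_decimate_eq_zero {A : Type*} {P : Set (ℕ → A)} (hinv : shift '' P = P)
    (j m : ℕ) : decimate j m '' P = decimate 0 m '' P := by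
  induction j with
  | zero => rfl
  | succ j ih =>
    rw [← ih]
    conv_rhs => rw [← hinv]
    simp only [Set.image_image, decimate_shift]

/-- For a shift-invariant path set, all decimations with the same modulus `m`
coincide, and each decimated set is shift-invariant. -/
theorem decimate_of_shiftInvariant {A : Type} [Fintype A] (P : Set (ℕ → A))
    (hP : IsPathSet P) (hinv : shift '' P = P) (m : ℕ) (hm : 1 ≤ m) (j : ℕ) :
    decimate j m '' P = decimate 0 m '' P ∧
    shift '' (decimate j m '' P) = decimate j m '' P := by
  refine ⟨image_decimate_eq_zero hinv j m, ?_⟩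
  simp only [Set.image_image, shift_decimate]
  exact (image_decimate_eq_zero hinv (j + m) m).trans (image_decimate_eq_zero hinv j m).symm
end

section
/- A set P ⊆ A^ℕ is a path set if and only if P is a closed subset of A^ℕ (product topology, A discrete) and there exists a finite collection 𝒞 of subsets of A^ℕ with P ∈ 𝒞 that is closed under the following operations: for every X ∈ 𝒞, the shift image σ '' X belongs to 𝒞, and for every X ∈ 𝒞 and every j ∈ A, the intersection X ∩ Z_j belongs to 𝒞. -/
theorem isClosed_pathSet {A V : Type*} [TopologicalSpace A] [DiscreteTopology A] [Finite V]
    (E : V → A → V → Prop) (v0 : V) : IsClosed (pathSet E v0) := by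
  let : TopologicalSpace V := ⊥
  have : DiscreteTopology V := ⟨rfl⟩
  have hstep (n : ℕ) :
      IsClosed {q : (ℕ → A) × (ℕ → V) | E (q.2 n) (q.1 n) (q.2 (n + 1))} := by
    have hcont : Continuous fun q : (ℕ → A) × (ℕ → V) => (q.2 n, q.1 n, q.2 (n + 1)) := by
      fun_prop
    exact (isClosed_discrete {t : V × A × V | E t.1 t.2.1 t.2.2}).preimage hcont
  have hstart : IsClosed {q : (ℕ → A) × (ℕ → V) | q.2 0 = v0} := by
    have hcont : Continuous fun q : (ℕ → A) × (ℕ → V) => q.2 0 := by fun_prop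
    exact (isClosed_discrete {v0}).preimage hcont
  have himage : pathSet E v0 = Prod.fst '' ({q : (ℕ → A) × (ℕ → V) | q.2 0 = v0} ∩
      ⋂ n, {q : (ℕ → A) × (ℕ → V) | E (q.2 n) (q.1 n) (q.2 (n + 1))}) := by
    ext x
    simp [pathSet]
  rw [himage]
  exact isClosedMap_fst_of_compactSpace _ (hstart.inter (isClosed_iInter hstep))

/-- The label sequences of infinite walks that start in `S` and whose first label is in `J`. -/
def pathSetFrom {A V : Type*} (E : V → A → V → Prop) (S : Set V) (J : Set A) : Set (ℕ → A) :=
  {x | (∃ v ∈ S, x ∈ pathSet E v) ∧ x 0 ∈ J}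

theorem shift_image_pathSetFrom {A V : Type*} (E : V → A → V → Prop) (S : Set V) (J : Set A) :
    shift '' pathSetFrom E S J =
      pathSetFrom E {w | ∃ v ∈ S, ∃ j ∈ J, E v j w} Set.univ := by
  ext y
  constructor
  · rintro ⟨x, ⟨⟨v, hv, p, rfl, hp⟩, hx⟩, rfl⟩
    exact ⟨⟨p 1, ⟨p 0, hv, x 0, hx, hp 0⟩, fun n => p (n + 1), rfl, fun n => hp (n + 1)⟩,
      trivial⟩
  · rintro ⟨⟨w, ⟨v, hv, j, hj, hE⟩, p, rfl, hp⟩, -⟩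
    refine ⟨fun n => Nat.casesOn n j y,
      ⟨⟨v, hv, fun n => Nat.casesOn n v p, rfl, ?_⟩, hj⟩, rfl⟩
    rintro (_ | n)
    exacts [hE, hp n]

theorem pathSetFrom_inter_head {A V : Type*} (E : V → A → V → Prop) (S : Set V) (J : Set A)
    (j : A) : pathSetFrom E S J ∩ {x | x 0 = j} = pathSetFrom E S (J ∩ {j}) := by
  ext x
  simp [pathSetFrom, and_assoc]

theorem pathSet_eq_pathSetFrom {A V : Type*} (E : V → A → V → Prop) (v0 : V) :
    pathSet E v0 = pathSetFrom E {v0} Set.univ := by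
  ext x
  simp [pathSetFrom]

/-- The graph on sets of sequences with an edge labeled `j` from `X` to the set of tails of
the sequences of `X` starting with `j`, provided there is one. -/
def tailEdge {A : Type*} (X : Set (ℕ → A)) (j : A) (Y : Set (ℕ → A)) : Prop :=
  Y = shift '' (X ∩ {x | x 0 = j}) ∧ Y.Nonempty

theorem exists_mem_of_tailEdge_walk {A : Type*} {X : ℕ → Set (ℕ → A)} {x : ℕ → A}
    (hX : ∀ n, tailEdge (X n) (x n) (X (n + 1))) (n : ℕ) {y : ℕ → A} (hy : y ∈ X n) :
    ∃ z ∈ X 0, (∀ i < n, z i = x i) ∧ ∀ i, z (n + i) = y i := by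
  induction n generalizing y with
  | zero => exact ⟨y, hy, by simp, by simp⟩
  | succ n ih =>
    rw [(hX n).1] at hy
    obtain ⟨w, ⟨hw, hwx⟩, rfl⟩ := hy
    obtain ⟨z, hz, hlt, htail⟩ := ih hw
    refine ⟨z, hz, fun i hi => ?_, fun i => ?_⟩
    · rcases Nat.lt_succ_iff_lt_or_eq.mp hi with h | rfl
      · exact hlt i h
      · exact (htail 0).trans hwx
    · rw [Nat.add_assoc, Nat.add_comm 1 i]
      exact htail (i + 1)

theorem IsClosed.mem_of_forall_exists_eq_lt {A : Type*} [TopologicalSpace A] {P : Set (ℕ → A)}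
    (hP : IsClosed P) {x : ℕ → A} (h : ∀ n, ∃ z ∈ P, ∀ i < n, z i = x i) : x ∈ P := by
  choose z hz hzx using h
  refine hP.mem_of_tendsto (f := z) (b := Filter.atTop) ?_ (Filter.Eventually.of_forall hz)
  refine tendsto_pi_nhds.mpr fun i => tendsto_const_nhds.congr' ?_
  filter_upwards [Filter.eventually_gt_atTop i] with n hn
  exact (hzx n i hn).symm

/-- Structure theorem for path sets: `P` is a path set iff `P` is closed and lies
in some finite collection of subsets of `A^ℕ` that is closed under the one-sided
shift image and under intersection with each prefix set `Z_j = {x | x 0 = j}`. -/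
theorem isPathSet_iff_structure {A : Type} [Fintype A] [TopologicalSpace A]
    [DiscreteTopology A] (P : Set (ℕ → A)) :
    IsPathSet P ↔
      (IsClosed P ∧
        ∃ 𝒞 : Set (Set (ℕ → A)), 𝒞.Finite ∧ P ∈ 𝒞 ∧
          (∀ X ∈ 𝒞, shift '' X ∈ 𝒞) ∧
          (∀ X ∈ 𝒞, ∀ j : A, X ∩ {x | x 0 = j} ∈ 𝒞)) := by
  constructor
  · rintro ⟨V, _, E, v0, rfl⟩
    refine ⟨isClosed_pathSet E v0, Set.range fun q : Set V × Set A => pathSetFrom E q.1 q.2,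
      Set.finite_range _, ⟨({v0}, Set.univ), (pathSet_eq_pathSetFrom E v0).symm⟩, ?_, ?_⟩
    · rintro _ ⟨⟨S, J⟩, rfl⟩
      exact ⟨(_, _), (shift_image_pathSetFrom E S J).symm⟩
    · rintro _ ⟨⟨S, J⟩, rfl⟩ j
      exact ⟨(_, _), (pathSetFrom_inter_head E S J j).symm⟩
  · rintro ⟨hP, 𝒞, hfin, hmem, hshift, hinter⟩
    refine ⟨𝒞, hfin.fintype, fun X j Y => tailEdge X.1 j Y.1, ⟨P, hmem⟩,
      Set.Subset.antisymm (fun x hx => ?_) ?_⟩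
    · let p : ℕ → 𝒞 := fun n => Nat.rec ⟨P, hmem⟩
        (fun n X => ⟨shift '' (X.1 ∩ {y | y 0 = x n}), hshift _ (hinter _ X.2 _)⟩) n
      have hp (n : ℕ) : (fun i => x (i + n)) ∈ (p n).1 := by
        induction n with
        | zero => exact hx
        | succ n ih =>
          refine ⟨_, ⟨ih, congrArg x (Nat.zero_add n)⟩, funext fun i => congrArg x ?_⟩
          lia
      exact ⟨p, rfl, fun n => ⟨rfl, _, hp (n + 1)⟩⟩
    · rintro x ⟨p, hp0, hp⟩
      have hX : ∀ n, tailEdge (p n).1 (x n) (p (n + 1)).1 := hp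
      refine hP.mem_of_forall_exists_eq_lt fun n => ?_
      obtain ⟨y, hy⟩ := (hX n).2
      obtain ⟨z, hz, hlt, -⟩ :=
        exists_mem_of_tailEdge_walk (X := fun n => (p n).1) hX (n + 1) hy
      rw [hp0] at hz
      exact ⟨z, hz, fun i hi => hlt i (by lia)⟩
end

section
/- For every path set P ⊆ A^ℕ, the sequence n ↦ (1/n)·log N^I_n(P) and the sequence n ↦ (1/n)·log N_n(P) both converge as n → ∞ and have the same limit; in particular the path topological entropy and the topological entropy coincide: H_p(P) = H_top(P), and the limsups in their definitions are attained as limits. -/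
/-- The number of distinct initial blocks of length `n` of elements of `P`. -/
noncomputable def numInitialBlocks {A : Type*} [Fintype A] (P : Set (ℕ → A)) (n : ℕ) : ℕ :=
  Nat.card {w : Fin n → A | ∃ x ∈ P, ∀ i : Fin n, w i = x i}

/-- The number of distinct blocks of length `n` occurring anywhere in elements of `P`. -/
noncomputable def numBlocks {A : Type*} [Fintype A] (P : Set (ℕ → A)) (n : ℕ) : ℕ :=
  Nat.card {w : Fin n → A | ∃ x ∈ P, ∃ k : ℕ, ∀ i : Fin n, w i = x (k + i)}

open Filter in
/-- Two sequences of positive naturals that bound each other up to a constant factor have the same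
exponential growth rate. -/
lemma tendsto_log_div_of_le_const_mul {a b : ℕ → ℕ} {C : ℕ} {h : ℝ} (hpos : ∀ n, 0 < a n)
    (hle : ∀ n, a n ≤ b n) (hge : ∀ᶠ n in atTop, b n ≤ C * a n)
    (hb : Tendsto (fun n : ℕ => Real.log (b n) / n) atTop (nhds h)) :
    Tendsto (fun n : ℕ => Real.log (a n) / n) atTop (nhds h) := by
  have hC : Tendsto (fun n : ℕ => Real.log (b n) / n - Real.log C / n) atTop (nhds h) := by
    simpa using hb.sub (tendsto_const_div_atTop_nhds_zero_nat (Real.log C))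
  refine tendsto_of_tendsto_of_tendsto_of_le_of_le' hC hb ?_ (.of_forall fun n => ?_)
  · filter_upwards [hge] with n hn
    have ha : (0 : ℝ) < a n := by exact_mod_cast hpos n
    have hbn : (0 : ℝ) < b n := by exact_mod_cast (hpos n).trans_le (hle n)
    have hC0 : (C : ℝ) ≠ 0 := by
      intro h0
      have := (hpos n).trans_le ((hle n).trans hn)
      simp_all
    rw [← sub_div]
    gcongr
    rw [sub_le_iff_le_add', ← Real.log_mul hC0 ha.ne']
    exact Real.log_le_log hbn (by exact_mod_cast hn)
  · have ha : (0 : ℝ) < a n := by exact_mod_cast hpos n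
    have := hle n
    gcongr

section Blocks

variable {A : Type*} [Fintype A] (P : Set (ℕ → A))

lemma numInitialBlocks_pos (hP : P.Nonempty) (n : ℕ) : 0 < numInitialBlocks P n := by
  obtain ⟨x, hx⟩ := hP
  have : Nonempty {w : Fin n → A | ∃ x ∈ P, ∀ i : Fin n, w i = x i} :=
    ⟨fun i => x i, x, hx, fun _ => rfl⟩
  exact Nat.card_pos

lemma numInitialBlocks_le_numBlocks (n : ℕ) : numInitialBlocks P n ≤ numBlocks P n := by
  refine Nat.card_mono (Set.toFinite _) ?_
  rintro w ⟨x, hx, hw⟩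
  exact ⟨x, hx, 0, by simpa using hw⟩

lemma numBlocks_add_le (m n : ℕ) : numBlocks P (m + n) ≤ numBlocks P m * numBlocks P n := by
  rw [numBlocks, numBlocks, numBlocks, ← Nat.card_prod]
  refine Nat.card_le_card_of_injective (fun w => (⟨fun i => w.1 (Fin.castAdd n i), ?_⟩,
    ⟨fun i => w.1 (Fin.natAdd m i), ?_⟩)) ?_
  · obtain ⟨x, hx, k, hw⟩ := w.2
    exact ⟨x, hx, k, fun i => hw _⟩
  · obtain ⟨x, hx, k, hw⟩ := w.2
    exact ⟨x, hx, k + m, fun i => by simp [hw, add_assoc]⟩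
  · rintro ⟨w, hw⟩ ⟨w', hw'⟩ h
    simp only [Prod.mk.injEq, Subtype.mk.injEq, funext_iff] at h
    exact Subtype.ext (funext fun i => Fin.addCases h.1 h.2 i)

/-- If every block of `P` occurs at a position below `K`, then initial blocks of length `n + K`
contain all blocks of length `n`. -/
lemma numBlocks_le_mul_numInitialBlocks_add {K : ℕ}
    (hK : ∀ x ∈ P, ∀ k, ∃ y ∈ P, ∃ j < K, ∀ i, x (k + i) = y (j + i)) (n : ℕ) :
    numBlocks P n ≤ K * numInitialBlocks P (n + K) := by
  have hcard : Nat.card (Fin K × {w : Fin (n + K) → A | ∃ x ∈ P, ∀ i : Fin (n + K), w i = x i}) =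
      K * numInitialBlocks P (n + K) := by
    rw [Nat.card_prod, Nat.card_fin, numInitialBlocks]
  rw [← hcard]
  refine Nat.card_le_card_of_surjective (fun q => ⟨fun i => q.2.1 ⟨q.1 + i, by omega⟩, ?_⟩) ?_
  · obtain ⟨x, hx, hw⟩ := q.2.2
    exact ⟨x, hx, q.1, fun i => hw _⟩
  · rintro ⟨w, x, hx, k, hw⟩
    obtain ⟨y, hy, j, hj, hxy⟩ := hK x hx k
    exact ⟨(⟨j, hj⟩, ⟨fun i => y i, y, hy, fun _ => rfl⟩),
      Subtype.ext (funext fun i => by simp [hw, hxy])⟩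

open Filter in
/-- The growth rate of the number of blocks exists, by Fekete's lemma. -/
lemma exists_tendsto_log_numBlocks_div (hP : P.Nonempty) :
    ∃ h : ℝ, Tendsto (fun n : ℕ => Real.log (numBlocks P n) / n) atTop (nhds h) := by
  have hpos (n : ℕ) : (0 : ℝ) < numBlocks P n := by
    exact_mod_cast (numInitialBlocks_pos P hP n).trans_le (numInitialBlocks_le_numBlocks P n)
  have hsub : Subadditive fun n => Real.log (numBlocks P n) := fun m n => by
    rw [← Real.log_mul (hpos m).ne' (hpos n).ne']
    exact Real.log_le_log (hpos _) (by exact_mod_cast numBlocks_add_le P m n)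
  refine ⟨_, hsub.tendsto_lim ⟨0, ?_⟩⟩
  rintro _ ⟨n, rfl⟩
  positivity

end Blocks

/-- In a finite pointed graph, every tail of a presented sequence is a tail at bounded position. -/
lemma exists_tail_eq_of_pathSet {A V : Type*} [Finite V] (E : V → A → V → Prop) (v0 : V) :
    ∃ K : ℕ, ∀ x ∈ pathSet E v0, ∀ k, ∃ y ∈ pathSet E v0, ∃ j < K, ∀ i, x (k + i) = y (j + i) := by
  have hex (v : V) : ∃ j : ℕ,
      (∃ (y : ℕ → A) (q : ℕ → V), q 0 = v0 ∧ (∀ n, E (q n) (y n) (q (n + 1))) ∧ q j = v) ∨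
      ¬ ∃ (j : ℕ) (y : ℕ → A) (q : ℕ → V),
        q 0 = v0 ∧ (∀ n, E (q n) (y n) (q (n + 1))) ∧ q j = v := by
    by_cases h : ∃ (j : ℕ) (y : ℕ → A) (q : ℕ → V),
        q 0 = v0 ∧ (∀ n, E (q n) (y n) (q (n + 1))) ∧ q j = v
    · exact h.imp fun _ => Or.inl
    · exact ⟨0, Or.inr h⟩
  choose f hf using hex
  obtain ⟨K, hK⟩ := (Set.finite_range f).bddAbove
  refine ⟨K + 1, ?_⟩
  rintro x ⟨p, hp0, hp⟩ k
  obtain ⟨y, q, hq0, hq, hqk⟩ := (hf (p k)).resolve_right (not_not.2 ⟨k, x, p, hp0, hp, rfl⟩)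
  set j := f (p k)
  refine ⟨fun n => if n < j then y n else x (k + (n - j)),
    ⟨fun n => if n < j then q n else p (k + (n - j)), ?_, fun n => ?_⟩,
    j, Nat.lt_succ_of_le (hK ⟨_, rfl⟩), fun i => by simp⟩
  · by_cases hj : 0 < j
    · simp [hj, hq0]
    · have hj0 : j = 0 := by omega
      simp [hj0, ← hqk, hq0]
  · rcases lt_trichotomy (n + 1) j with h | h | h
    · simpa [h, (Nat.lt_succ_self n).trans h] using hq n
    · have := hq n
      rw [h, hqk] at this
      simpa [h, show n < j by omega] using this
    · have hn : n + 1 - j = n - j + 1 := by omega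
      simpa [show ¬ n + 1 < j by omega, show ¬ n < j by omega, hn, add_assoc] using hp (k + (n - j))

/-- For a path set, the sequences `(1/n) log N^I_n(P)` and `(1/n) log N_n(P)` both
converge and have the same limit; in particular the path topological entropy and
the topological entropy coincide, and the limsups are attained as limits. -/
theorem entropy_eq_pathEntropy {A : Type} [Fintype A] (P : Set (ℕ → A))
    (hP : IsPathSet P) :
    ∃ h : ℝ,
      Filter.Tendsto (fun n : ℕ => Real.log (numInitialBlocks P n) / n)
        Filter.atTop (nhds h) ∧
      Filter.Tendsto (fun n : ℕ => Real.log (numBlocks P n) / n)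
        Filter.atTop (nhds h) := by
  obtain ⟨V, _, E, v0, rfl⟩ := hP
  rcases (pathSet E v0).eq_empty_or_nonempty with h0 | hne
  · exact ⟨0, by simp [h0, numInitialBlocks], by simp [h0, numBlocks]⟩
  obtain ⟨K, hK⟩ := exists_tail_eq_of_pathSet E v0
  obtain ⟨h, hh⟩ := exists_tendsto_log_numBlocks_div _ hne
  refine ⟨h, tendsto_log_div_of_le_const_mul (C := K * numBlocks (pathSet E v0) K)
    (numInitialBlocks_pos _ hne) (numInitialBlocks_le_numBlocks _) ?_ hh, hh⟩
  filter_upwards [Filter.eventually_ge_atTop K] with m hm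
  obtain ⟨n, rfl⟩ := Nat.exists_eq_add_of_le' hm
  calc numBlocks (pathSet E v0) (n + K)
      ≤ numBlocks (pathSet E v0) n * numBlocks (pathSet E v0) K := numBlocks_add_le _ n K
    _ ≤ K * numInitialBlocks (pathSet E v0) (n + K) * numBlocks (pathSet E v0) K := by
        gcongr
        exact numBlocks_le_mul_numInitialBlocks_add _ hK n
    _ = _ := by ring
end

section
/- For every n ≥ 2 there exist a finite type V with exactly n elements and a right-resolving labeled-edge relation E : V → Fin (2n) → V → Prop such that, letting Y = ⋃_{v : V} X_{(V,E)}(v) be the associated one-sided sofic shift over the alphabet Fin (2n), every pointed graph (W, F, w0) over Fin (2n) with F right-resolving and X_{(W,F)}(w0) = Y has at least 2^n − 1 vertices. In other words, presenting a one-sided sofic shift as a path set via a right-resolving pointed graph can require an exponential blow-up in the number of vertices. -/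
/-- The graph on `Fin n` in which each vertex `v` carries a loop for every label except `v`. -/
def avoidingLoops (n : ℕ) (v : Fin n) (a : Fin (2 * n)) (w : Fin n) : Prop :=
  w = v ∧ a.val ≠ v.val

theorem mem_iUnion_pathSet_avoidingLoops {n : ℕ} {x : ℕ → Fin (2 * n)} :
    x ∈ ⋃ v, pathSet (avoidingLoops n) v ↔ ∃ v : Fin n, ∀ k, (x k).val ≠ v.val := by
  simp only [Set.mem_iUnion]
  refine exists_congr fun v => ⟨?_, fun h => ⟨fun _ => v, rfl, fun k => ⟨rfl, h k⟩⟩⟩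
  rintro ⟨p, hp0, hp⟩ k
  have hconst : ∀ m, p m = v := by
    intro m
    induction m with
    | zero => exact hp0
    | succ m ih => rw [(hp m).1, ih]
  exact hconst k ▸ (hp k).2

/-- In a right-resolving graph, walks from a common vertex whose labels agree on the first `n`
steps agree up to time `n`. -/
theorem RightResolving.walk_eq {A W : Type*} {F : W → A → W → Prop} (hF : RightResolving F)
    {p q : ℕ → W} {x y : ℕ → A} (h0 : p 0 = q 0) (hp : ∀ k, F (p k) (x k) (p (k + 1)))
    (hq : ∀ k, F (q k) (y k) (q (k + 1))) {n : ℕ} (hxy : ∀ k < n, x k = y k) :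
    ∀ k ≤ n, p k = q k := by
  intro k
  induction k with
  | zero => exact fun _ => h0
  | succ k ih =>
    intro hk
    refine hF (p k) (x k) _ _ (hp k) ?_
    rw [ih (by omega), hxy k (by omega)]
    exact hq k

/-- The first `n` terms of `x` followed by the sequence `y`. -/
def spliceAt {A : Type*} (n : ℕ) (x y : ℕ → A) (k : ℕ) : A :=
  if k < n then x k else y (k - n)

theorem spliceAt_add {A : Type*} (n : ℕ) (x y : ℕ → A) (k : ℕ) :
    spliceAt n x y (n + k) = y k := by
  simp [spliceAt]

/-- If walks labeled `x` and `x'` from `w0` reach the same vertex at time `n`, then every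
continuation of the first one is a continuation of the second one. -/
theorem RightResolving.spliceAt_mem_pathSet {A W : Type*} {F : W → A → W → Prop}
    (hF : RightResolving F) {w0 : W} {n : ℕ} {x x' y : ℕ → A} {p p' : ℕ → W}
    (hp0 : p 0 = w0) (hp : ∀ k, F (p k) (x k) (p (k + 1)))
    (hp0' : p' 0 = w0) (hp' : ∀ k, F (p' k) (x' k) (p' (k + 1))) (hpp' : p n = p' n)
    (h : spliceAt n x y ∈ pathSet F w0) : spliceAt n x' y ∈ pathSet F w0 := by
  obtain ⟨q, hq0, hq⟩ := h
  have hpq : p n = q n :=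
    hF.walk_eq (hp0.trans hq0.symm) hp hq (fun k hk => by simp [spliceAt, hk]) n le_rfl
  refine ⟨fun k => if k ≤ n then p' k else q k, by simpa using hp0', fun k => ?_⟩
  rcases lt_trichotomy k n with hk | rfl | hk
  · simpa [spliceAt, hk, hk.le, Nat.succ_le_iff] using hp' k
  · have := hq k
    rw [← hpq, hpp'] at this
    simpa [spliceAt] using this
  · have h1 : ¬ k ≤ n := by omega
    have h2 : ¬ k + 1 ≤ n := by omega
    have h3 : ¬ k < n := by omega
    simpa [spliceAt, h1, h2, h3] using hq k

/-- A sequence whose labels below `n` are exactly the elements of `S`, all of them occurring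
before time `n`; every other label is `n`. -/
def listing {n : ℕ} (hn : 0 < n) (S : Finset (Fin n)) (k : ℕ) : Fin (2 * n) :=
  if h : ∃ hk : k < n, (⟨k, hk⟩ : Fin n) ∈ S then ⟨k, by have := h.1; omega⟩
  else ⟨n, by omega⟩

theorem listing_of_mem {n : ℕ} (hn : 0 < n) {S : Finset (Fin n)} {v : Fin n} (hv : v ∈ S) :
    (listing hn S v).val = v.val := by
  simp [listing, hv]

theorem listing_ne {n : ℕ} (hn : 0 < n) {S : Finset (Fin n)} {v : Fin n} (hv : v ∉ S) (k : ℕ) :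
    (listing hn S k).val ≠ v.val := by
  unfold listing
  split_ifs with h
  · rintro rfl
    exact hv h.2
  · exact v.isLt.ne'

theorem spliceAt_listing_mem {n : ℕ} (hn : 0 < n) {S T : Finset (Fin n)} :
    spliceAt n (listing hn Sᶜ) (listing hn T) ∈ ⋃ v, pathSet (avoidingLoops n) v ↔ ¬ S ⊆ T := by
  rw [mem_iUnion_pathSet_avoidingLoops, Finset.not_subset]
  refine exists_congr fun v => ⟨fun h => ⟨?_, fun hvT => ?_⟩, fun ⟨hvS, hvT⟩ k => ?_⟩
  · by_contra hvS
    refine h v ?_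
    simpa [spliceAt] using listing_of_mem hn (Finset.mem_compl.2 hvS)
  · refine h (n + v) ?_
    rw [spliceAt_add]
    exact listing_of_mem hn hvT
  · unfold spliceAt
    split_ifs
    · exact listing_ne hn (by simpa using hvS) k
    · exact listing_ne hn hvT _

/-- Exponential blow-up: for every `n ≥ 2` there is a right-resolving labeled
graph on `n` vertices over the alphabet `Fin (2n)` whose associated one-sided
sofic shift requires at least `2^n - 1` vertices in any right-resolving pointed
graph presenting it as a path set. -/
theorem sofic_to_pathSet_exponential_blowup (n : ℕ) (hn : 2 ≤ n) :
    ∃ (V : Type) (E : V → Fin (2 * n) → V → Prop), Finite V ∧ Nat.card V = n ∧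
      RightResolving E ∧
      ∀ (W : Type) (F : W → Fin (2 * n) → W → Prop) (w0 : W), Finite W →
        RightResolving F → pathSet F w0 = ⋃ v : V, pathSet E v →
        2 ^ n - 1 ≤ Nat.card W := by
  have hn0 : 0 < n := by omega
  refine ⟨Fin n, avoidingLoops n, inferInstance, Nat.card_fin n,
    fun v a w w' h h' => h.1.trans h'.1.symm, fun W F w0 _ hF hY => ?_⟩
  have hwalk : ∀ S : {S : Finset (Fin n) // S ≠ ∅}, ∃ p : ℕ → W, p 0 = w0 ∧
      ∀ k, F (p k) (listing hn0 S.1ᶜ k) (p (k + 1)) := by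
    rintro ⟨S, hS⟩
    obtain ⟨v, hv⟩ := Finset.nonempty_iff_ne_empty.2 hS
    have hmem : listing hn0 Sᶜ ∈ pathSet F w0 := by
      rw [hY, mem_iUnion_pathSet_avoidingLoops]
      exact ⟨v, listing_ne hn0 (by simpa using hv)⟩
    exact hmem
  choose p hp0 hp using hwalk
  have hsub : ∀ S T, p S n = p T n → S.1 ⊆ T.1 := by
    intro S T hST
    by_contra h
    have hmem := hF.spliceAt_mem_pathSet (hp0 S) (hp S) (hp0 T) (hp T) hST
      (hY ▸ (spliceAt_listing_mem hn0).2 h)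
    rw [hY] at hmem
    exact (spliceAt_listing_mem hn0).1 hmem subset_rfl
  have hinj : Function.Injective fun S => p S n := fun S T h =>
    Subtype.ext ((hsub S T h).antisymm (hsub T S h.symm))
  have hcard : Nat.card {S : Finset (Fin n) // S ≠ ∅} = 2 ^ n - 1 := by
    simp [Nat.card_eq_fintype_card, Fintype.card_subtype_compl]
  exact hcard ▸ Nat.card_le_card_of_injective _ hinj
end

section
/- Let (V, E) be a finite labeled graph over A and let Y ⊆ A^ℤ be the associated two-sided sofic shift. Then for every finite word w ∈ List A, the infinite follower set F̄_Y(w) ⊆ A^ℕ is a path set over the same alphabet A. -/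
/-- The two-sided sofic shift associated to a labeled graph: all label sequences
of bi-infinite walks in the graph. -/
def twoSidedSofic {A V : Type*} (E : V → A → V → Prop) : Set (ℤ → A) :=
  {y | ∃ p : ℤ → V, ∀ n : ℤ, E (p n) (y n) (p (n + 1))}

/-- The infinite follower set of the finite word `w` in the two-sided shift space
`Y`: all one-sided infinite sequences `s` that can directly follow an occurrence
of `w` in an element of `Y`. -/
def infiniteFollowerSet {A : Type*} (Y : Set (ℤ → A)) (w : List A) : Set (ℕ → A) :=
  {s | ∃ y ∈ Y, (∀ (i : ℕ) (h : i < w.length),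
      y ((i : ℤ) - (w.length : ℤ)) = w.get ⟨i, h⟩) ∧ ∀ n : ℕ, y (n : ℤ) = s n}

/-- The label sequences of infinite walks in a finite graph starting from any vertex of a
given set form a path set. -/
theorem isPathSet_setOf_walk_from {A V : Type} [Fintype A] [Fintype V] (E : V → A → V → Prop)
    (T : Set V) : IsPathSet {x | ∃ p : ℕ → V, p 0 ∈ T ∧ ∀ n, E (p n) (x n) (p (n + 1))} := by
  let F : Option V → A → Option V → Prop := fun a l b =>
    ∃ v, b = some v ∧ ∃ u, E u l v ∧ (a = some u ∨ a = none ∧ u ∈ T)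
  refine ⟨Option V, inferInstance, F, none, ?_⟩
  ext x
  constructor
  · rintro ⟨p, h0, hp⟩
    refine ⟨fun n => if n = 0 then none else some (p n), by simp, fun n => ?_⟩
    refine ⟨p (n + 1), by simp, p n, hp n, ?_⟩
    rcases n with _ | n
    · exact Or.inr ⟨by simp, h0⟩
    · exact Or.inl (by simp)
  · rintro ⟨q, h0, hq⟩
    choose r hr u hu hq' using hq
    refine ⟨u, ?_, fun n => ?_⟩
    · rcases hq' 0 with h | h
      · simp [h0] at h
      · exact h.2
    · have h : u (n + 1) = r n := by
        rcases hq' (n + 1) with h | h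
        · rw [hr n] at h
          exact (Option.some.inj h).symm
        · simp [hr n] at h
      rw [h]
      exact hu n

/-- The vertices reached at time `0` by left-infinite walks whose label sequence ends in `w`. -/
def leftInfiniteEndpoints {A V : Type*} (E : V → A → V → Prop) (w : List A) : Set V :=
  {v | ∃ (p : ℤ → V) (y : ℤ → A), p 0 = v ∧ (∀ n < 0, E (p n) (y n) (p (n + 1))) ∧
    ∀ (i : ℕ) (h : i < w.length), y ((i : ℤ) - (w.length : ℤ)) = w.get ⟨i, h⟩}

theorem infiniteFollowerSet_twoSidedSofic {A V : Type*} (E : V → A → V → Prop) (w : List A) :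
    infiniteFollowerSet (twoSidedSofic E) w =
      {x | ∃ p : ℕ → V, p 0 ∈ leftInfiniteEndpoints E w ∧
        ∀ n, E (p n) (x n) (p (n + 1))} := by
  ext s
  constructor
  · rintro ⟨y, ⟨p, hp⟩, hw, hs⟩
    refine ⟨fun n => p n, ⟨p, y, rfl, fun n _ => hp n, hw⟩, fun n => ?_⟩
    rw [← hs n]
    exact_mod_cast hp n
  · rintro ⟨r, ⟨p, y, h0, hp, hw⟩, hr⟩
    refine ⟨fun n => if n < 0 then y n else s n.toNat,
      ⟨fun n => if n < 0 then p n else r n.toNat, fun n => ?_⟩, fun i h => ?_, fun n => ?_⟩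
    · rcases lt_or_ge n 0 with hn | hn
      · have hpn := hp n hn
        rcases lt_or_ge (n + 1) 0 with hn' | hn'
        · simpa [hn, hn'] using hpn
        · obtain rfl : n = -1 := by omega
          simpa [h0] using hpn
      · lift n to ℕ using hn
        have hn : ¬ ((n : ℤ) < 0) := by omega
        have h1 : ¬ ((n : ℤ) + 1 < 0) := by omega
        have h2 : ((n : ℤ) + 1).toNat = n + 1 := by omega
        simpa [hn, h1, h2] using hr n
    · have hi : (i : ℤ) - (w.length : ℤ) < 0 := by omega
      simpa only [if_pos hi] using hw i h
    · simp

/-- Every infinite follower set of a two-sided sofic shift is a path set over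
the same alphabet. -/
theorem isPathSet_infiniteFollowerSet {A : Type} [Fintype A] {V : Type}
    [Fintype V] (E : V → A → V → Prop) (w : List A) :
    IsPathSet (infiniteFollowerSet (twoSidedSofic E) w) := by
  rw [infiniteFollowerSet_twoSidedSofic]
  exact isPathSet_setOf_walk_from E _
end

section
/- Over the alphabet Fin 2, the prefix set Z_1 = {x : ℕ → Fin 2 | x 0 = 1} is a path set, but it is not an infinite follower set of any two-sided sofic shift over Fin 2: there is no finite labeled graph (V, E) over Fin 2, with associated two-sided sofic shift Y ⊆ (Fin 2)^ℤ, and no finite word w ∈ List (Fin 2) such that F̄_Y(w) = Z_1. -/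
/-- A two-sided sofic shift is invariant under every integer shift. -/
theorem shift_mem_twoSidedSofic {A V : Type*} {E : V → A → V → Prop} {y : ℤ → A}
    (hy : y ∈ twoSidedSofic E) (m : ℤ) : (fun n => y (n + m)) ∈ twoSidedSofic E := by
  obtain ⟨p, hp⟩ := hy
  refine ⟨fun n => p (n + m), fun n => ?_⟩
  simpa only [add_right_comm] using hp (n + m)

/-- If `s` follows `w` in a sofic shift and `w` occurs in `s` at position `m`, then the tail of `s`
after that occurrence also follows `w`. -/
theorem tail_mem_infiniteFollowerSet {A V : Type*} {E : V → A → V → Prop} {w : List A}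
    {s : ℕ → A} (hs : s ∈ infiniteFollowerSet (twoSidedSofic E) w) (m : ℕ)
    (hw : ∀ (i : ℕ) (h : i < w.length), s (m + i) = w.get ⟨i, h⟩) :
    (fun n => s (m + w.length + n)) ∈ infiniteFollowerSet (twoSidedSofic E) w := by
  obtain ⟨y, hy, -, hys⟩ := hs
  refine ⟨_, shift_mem_twoSidedSofic hy (m + w.length : ℕ), fun i h => ?_, fun n => ?_⟩
  · rw [← hw i h, ← hys]
    congr 1
    push_cast
    ring
  · dsimp only
    rw [← hys]
    congr 1
    push_cast
    ring

/-- The set of sequences starting with a fixed letter is a path set. -/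
theorem isPathSet_head_eq {A : Type*} [Fintype A] (a : A) : IsPathSet {x : ℕ → A | x 0 = a} := by
  refine ⟨Bool, inferInstance, fun v b v' => v' = true ∧ (v = false → b = a), false, ?_⟩
  ext x
  constructor
  · intro hx
    refine ⟨fun n => decide (n ≠ 0), by simp, fun n => ⟨by simp, fun hn => ?_⟩⟩
    obtain rfl : n = 0 := by simpa using hn
    exact hx
  · rintro ⟨p, hp0, hp⟩
    exact (hp 0).2 hp0

/-- Over the alphabet `Fin 2`, the prefix set `Z_1` is a path set but is not an
infinite follower set of any two-sided sofic shift over `Fin 2`. -/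
theorem prefixSet_not_followerSet :
    IsPathSet {x : ℕ → Fin 2 | x 0 = 1} ∧
    ¬ ∃ (V : Type) (_ : Fintype V) (E : V → Fin 2 → V → Prop) (w : List (Fin 2)),
        infiniteFollowerSet (twoSidedSofic E) w = {x : ℕ → Fin 2 | x 0 = 1} := by
  refine ⟨isPathSet_head_eq 1, ?_⟩
  rintro ⟨V, _, E, w, hF⟩
  have hs : (fun n => (1 :: w).getD n 0) ∈ infiniteFollowerSet (twoSidedSofic E) w := by
    rw [hF]
    simp
  have htail := tail_mem_infiniteFollowerSet hs 1 fun i h => by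
    simp [add_comm 1 i, h]
  rw [hF] at htail
  simp [add_comm 1 w.length] at htail
end

section
/- Let P ⊆ A^ℕ be a path set. Then, over the enlarged alphabet Option A (which adds one extra symbol 'none' to A), there exist a finite labeled graph (V, E) over Option A, with associated two-sided sofic shift Y ⊆ (Option A)^ℤ, and a finite word w ∈ List (Option A) such that the infinite follower set F̄_Y(w) equals the image of P under the coordinatewise embedding, i.e., F̄_Y(w) = {y : ℕ → Option A | ∃ x ∈ P, y = fun n => some (x n)}. -/
/-- The graph `E` with an added vertex `none` that carries a loop for every letter of `A` and
emits a single edge, labeled by the new symbol `none`, into the distinguished vertex `v0`. -/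
def markedEdge {A V : Type*} (E : V → A → V → Prop) (v0 : V) :
    Option V → Option A → Option V → Prop
  | none, some _, none => True
  | none, none, some v => v = v0
  | some u, some a, some v => E u a v
  | _, _, _ => False

theorem markedEdge_none_label {A V : Type*} {E : V → A → V → Prop} {v0 : V} {u v : Option V}
    (h : markedEdge E v0 u none v) : v = some v0 := by
  rcases u with _ | u <;> rcases v with _ | v <;> simp_all [markedEdge]

theorem markedEdge_some_source {A V : Type*} {E : V → A → V → Prop} {v0 u : V} {b : Option A}
    {v : Option V} (h : markedEdge E v0 (some u) b v) :
    ∃ a v', b = some a ∧ v = some v' ∧ E u a v' := by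
  rcases b with _ | a <;> rcases v with _ | v <;> simp_all [markedEdge]

theorem infiniteFollowerSet_markedEdge {A V : Type*} (E : V → A → V → Prop) (v0 : V) :
    infiniteFollowerSet (twoSidedSofic (markedEdge E v0)) [none] =
      {y : ℕ → Option A | ∃ x ∈ pathSet E v0, y = fun n => some (x n)} := by
  ext s
  constructor
  · rintro ⟨y, ⟨p, hp⟩, hw, hs⟩
    have hy : y (-1) = none := by simpa using hw 0 (by simp)
    have hp0 : p 0 = some v0 := by
      have h := hp (-1)
      rw [hy] at h
      simpa using markedEdge_none_label h
    have hstep (n : ℕ) : markedEdge E v0 (p n) (s n) (p ((n + 1 : ℕ) : ℤ)) := by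
      simpa [hs] using hp n
    have hvertex (n : ℕ) : ∃ v, p n = some v := by
      induction n with
      | zero => exact ⟨v0, by simpa using hp0⟩
      | succ n ih =>
        obtain ⟨v, hv⟩ := ih
        have h := hstep n
        rw [hv] at h
        obtain ⟨_, v', _, hv', _⟩ := markedEdge_some_source h
        exact ⟨v', hv'⟩
    choose q hq using hvertex
    have hedge (n : ℕ) : ∃ a, s n = some a ∧ E (q n) a (q (n + 1)) := by
      have h := hstep n
      rw [hq n, hq (n + 1)] at h
      obtain ⟨a, v', ha, hv', hE⟩ := markedEdge_some_source h
      exact ⟨a, ha, Option.some.inj hv' ▸ hE⟩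
    choose x hx hE using hedge
    refine ⟨x, ⟨q, ?_, hE⟩, funext hx⟩
    have h := hq 0
    rw [Nat.cast_zero, hp0] at h
    exact (Option.some.inj h).symm
  · rintro ⟨x, ⟨q, hq0, hq⟩, rfl⟩
    refine ⟨fun n => if 0 ≤ n then some (x n.toNat) else if n = -1 then none else some (x 0),
      ⟨fun n => if 0 ≤ n then some (q n.toNat) else none, fun n => ?_⟩, ?_, ?_⟩
    · rcases lt_trichotomy n (-1) with h | rfl | h
      · simp [show ¬ 0 ≤ n by omega, show ¬ 0 ≤ n + 1 by omega, h.ne, markedEdge]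
      · simp [markedEdge, hq0]
      · have hn : 0 ≤ n := by omega
        lift n to ℕ using hn
        simpa [markedEdge, show (0 : ℤ) ≤ n + 1 by omega] using hq n
    · intro i hi
      obtain rfl : i = 0 := by simpa using hi
      simp
    · simp

/-- Every path set over `A` is representable as an infinite follower set of a
two-sided sofic shift over the enlarged alphabet `Option A` (one extra symbol),
after embedding `A^ℕ` into `(Option A)^ℕ` coordinatewise. -/
theorem pathSet_is_followerSet_over_enlarged_alphabet {A : Type} [Fintype A]
    (P : Set (ℕ → A)) (hP : IsPathSet P) :
    ∃ (V : Type) (_ : Fintype V) (E : V → Option A → V → Prop)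
      (w : List (Option A)),
      infiniteFollowerSet (twoSidedSofic E) w =
        {y : ℕ → Option A | ∃ x ∈ P, y = fun n => some (x n)} := by
  obtain ⟨V, _, E, v0, rfl⟩ := hP
  exact ⟨Option V, inferInstance, markedEdge E v0, [none], infiniteFollowerSet_markedEdge E v0⟩
end

section
/- Over the alphabet Fin 2, the set C = {x : ℕ → Fin 2 | ∃ n, x n = 1 ∧ x (n+1) = 1} of all sequences in which the block 11 occurs at least once is not a path set. (C is the complement of a path set, namely of the set of sequences avoiding the block 11; hence the collection of path sets over a fixed alphabet is not closed under complementation.) -/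
/-- If a finite pointed graph presents a sequence starting with at least `card V` copies of `a`,
then it also presents the constant sequence `a`. -/
theorem const_mem_pathSet {A V : Type*} [Fintype V] {E : V → A → V → Prop} {v0 : V}
    {x : ℕ → A} {a : A} (hx : x ∈ pathSet E v0) (ha : ∀ n < Fintype.card V, x n = a) :
    (fun _ => a) ∈ pathSet E v0 := by
  obtain ⟨p, hp0, hp⟩ := hx
  obtain ⟨i, j, hij, hj, hpij⟩ : ∃ i j, i < j ∧ j ≤ Fintype.card V ∧ p i = p j := by
    obtain ⟨i, j, hne, h⟩ := Fintype.exists_ne_map_eq_of_card_lt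
      (fun k : Fin (Fintype.card V + 1) => p k) (by simp)
    rcases lt_or_gt_of_ne hne with hlt | hlt
    · exact ⟨i, j, hlt, by omega, h⟩
    · exact ⟨j, i, hlt, by omega, h.symm⟩
  let f : ℕ → ℕ := fun n => Nat.rec 0 (fun _ k => if k + 1 = j then i else k + 1) n
  have hf_succ (n : ℕ) : f (n + 1) = if f n + 1 = j then i else f n + 1 := rfl
  have hf_lt (n : ℕ) : f n < j := by
    induction n with
    | zero => exact Nat.zero_lt_of_lt hij
    | succ n ih => rw [hf_succ]; split_ifs <;> omega
  have hpf (n : ℕ) : p (f (n + 1)) = p (f n + 1) := by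
    rw [hf_succ]
    split_ifs with h
    · rw [h, hpij]
    · rfl
  refine ⟨fun n => p (f n), hp0, fun n => ?_⟩
  have h := hp (f n)
  rwa [ha _ ((hf_lt n).trans_le hj), ← hpf] at h

/-- Over `Fin 2`, the set of sequences containing the block `11` somewhere is
not a path set; hence path sets are not closed under complementation. -/
theorem not_isPathSet_contains_block_11 :
    ¬ IsPathSet {x : ℕ → Fin 2 | ∃ n : ℕ, x n = 1 ∧ x (n + 1) = 1} := by
  rintro ⟨V, _, E, v0, h⟩
  have hx : (fun n => if n < Fintype.card V then 0 else 1 : ℕ → Fin 2) ∈ pathSet E v0 := by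
    rw [← h]
    exact ⟨Fintype.card V, by simp, by simp⟩
  have h0 := const_mem_pathSet (a := 0) hx fun n hn => by simp [hn]
  rw [← h] at h0
  obtain ⟨n, hn, -⟩ := h0
  exact zero_ne_one hn
end

section
/- Let S ⊆ A^ℕ be a closed subset (product topology, A discrete) with σ '' S ⊆ S. For a finite word w ∈ List A of length k, define the finite follower set F(w) = {u ∈ List A : the concatenation w ++ u is a prefix of some element of S} and the infinite follower set F̄(w) = {s ∈ A^ℕ : the sequence (w · s), which equals w_i at coordinates i < k and s(n − k) at coordinates n ≥ k, belongs to S}. Then the following are equivalent: (1) S is a one-sided sofic shift; (2) the collection {F̄(w) : w ∈ List A} of infinite follower sets is finite; (3) the collection {F(w) : w ∈ List A} of finite follower sets is finite. -/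
/-- A one-sided sofic shift: the set of label sequences of all one-sided infinite
walks in a finite labeled graph, starting from any vertex. -/
def IsOneSidedSofic {A : Type*} [Fintype A] (Y : Set (ℕ → A)) : Prop :=
  ∃ (V : Type) (_ : Fintype V) (E : V → A → V → Prop), Y = ⋃ v : V, pathSet E v

/-- The concatenation of the finite word `w` with the infinite sequence `s`. -/
def wordConcat {A : Type*} (w : List A) (s : ℕ → A) : ℕ → A :=
  fun n => if h : n < w.length then w.get ⟨n, h⟩ else s (n - w.length)

/-- The finite follower set of `w` in `S`: all finite words `u` such that
`w ++ u` is a prefix of some element of `S`. -/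
def finiteFollower {A : Type*} (S : Set (ℕ → A)) (w : List A) : Set (List A) :=
  {u | ∃ x ∈ S, ∀ (i : ℕ) (h : i < (w ++ u).length), x i = (w ++ u).get ⟨i, h⟩}

/-- The infinite follower set of `w` in `S`: all infinite sequences `s` such
that the concatenation `w · s` belongs to `S`. -/
def infiniteFollower {A : Type*} (S : Set (ℕ → A)) (w : List A) : Set (ℕ → A) :=
  {s | wordConcat w s ∈ S}

theorem wordConcat_apply_of_lt {A : Type*} (w : List A) (s : ℕ → A) {n : ℕ} (h : n < w.length) :
    wordConcat w s n = w[n] := by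
  simp [wordConcat, h]

theorem wordConcat_apply_of_le {A : Type*} (w : List A) (s : ℕ → A) {n : ℕ} (h : w.length ≤ n) :
    wordConcat w s n = s (n - w.length) := by
  simp [wordConcat, Nat.not_lt.mpr h]

@[simp]
theorem wordConcat_nil {A : Type*} (s : ℕ → A) : wordConcat [] s = s := by
  funext n
  simp [wordConcat]

@[simp]
theorem wordConcat_singleton_zero {A : Type*} (a : A) (s : ℕ → A) : wordConcat [a] s 0 = a := by
  simp [wordConcat]

@[simp]
theorem wordConcat_singleton_succ {A : Type*} (a : A) (s : ℕ → A) (n : ℕ) :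
    wordConcat [a] s (n + 1) = s n := by
  simp [wordConcat]

theorem wordConcat_append {A : Type*} (u v : List A) (s : ℕ → A) :
    wordConcat (u ++ v) s = wordConcat u (wordConcat v s) := by
  funext n
  rcases lt_or_ge n u.length with h | h
  · rw [wordConcat_apply_of_lt u _ h, wordConcat_apply_of_lt _ _ (by simp; omega),
      List.getElem_append_left h]
  · rw [wordConcat_apply_of_le u _ h]
    rcases lt_or_ge (n - u.length) v.length with h' | h'
    · rw [wordConcat_apply_of_lt v _ h', wordConcat_apply_of_lt _ _ (by simp; omega),
        List.getElem_append_right h]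
    · rw [wordConcat_apply_of_le v _ h', wordConcat_apply_of_le _ _ (by simp; omega)]
      simp [Nat.sub_sub]

/-- A sequence that starts with `w` is the concatenation of `w` with its tail. -/
theorem wordConcat_tail {A : Type*} (w : List A) (x : ℕ → A)
    (h : ∀ (i : ℕ) (hi : i < w.length), x i = w[i]) :
    wordConcat w (fun n => x (n + w.length)) = x := by
  funext n
  rcases lt_or_ge n w.length with hn | hn
  · rw [wordConcat_apply_of_lt _ _ hn, h n hn]
  · rw [wordConcat_apply_of_le _ _ hn, Nat.sub_add_cancel hn]

theorem wordConcat_map_range_tail {A : Type*} (x : ℕ → A) (n : ℕ) :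
    wordConcat ((List.range n).map x) (fun i => x (i + n)) = x := by
  simpa using wordConcat_tail ((List.range n).map x) x (by simp)

@[simp]
theorem infiniteFollower_nil {A : Type*} (S : Set (ℕ → A)) : infiniteFollower S [] = S := by
  simp [infiniteFollower]

theorem infiniteFollower_append {A : Type*} (S : Set (ℕ → A)) (u v : List A) :
    infiniteFollower S (u ++ v) = infiniteFollower (infiniteFollower S u) v := by
  simp [infiniteFollower, wordConcat_append]

theorem mem_finiteFollower_iff {A : Type*} (S : Set (ℕ → A)) (w u : List A) :
    u ∈ finiteFollower S w ↔ ∃ s, wordConcat u s ∈ infiniteFollower S w := by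
  simp only [infiniteFollower, Set.mem_ofPred_eq, ← wordConcat_append]
  constructor
  · rintro ⟨x, hx, h⟩
    exact ⟨fun n => x (n + (w ++ u).length), by rwa [wordConcat_tail _ x h]⟩
  · rintro ⟨s, hs⟩
    exact ⟨_, hs, fun i hi => wordConcat_apply_of_lt _ _ hi⟩

theorem infiniteFollower_subset {A : Type*} {S : Set (ℕ → A)} (hinv : shift '' S ⊆ S)
    (w : List A) : infiniteFollower S w ⊆ S := by
  induction w with
  | nil => simp
  | cons a w ih =>
    intro s hs
    refine ih (hinv ⟨wordConcat (a :: w) s, hs, ?_⟩)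
    rw [← List.singleton_append, wordConcat_append]
    funext n
    simp [shift]

/-- A point all of whose initial segments are initial segments of points of a closed set belongs
to that set. -/
theorem IsClosed.mem_of_forall_prefix {A : Type*} [TopologicalSpace A] [DiscreteTopology A]
    {S : Set (ℕ → A)} (hS : IsClosed S) {x : ℕ → A}
    (h : ∀ n, ∃ y ∈ S, ∀ i < n, y i = x i) : x ∈ S := by
  choose y hyS hy using h
  refine hS.mem_of_tendsto (b := Filter.atTop) (f := y) ?_ (Filter.Eventually.of_forall hyS)
  rw [tendsto_pi_nhds]
  intro i
  refine tendsto_const_nhds.congr' ?_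
  filter_upwards [Filter.eventually_gt_atTop i] with n hn
  exact (hy n i hn).symm

theorem mem_infiniteFollower_iff_forall_prefix {A : Type*} [TopologicalSpace A]
    [DiscreteTopology A] {S : Set (ℕ → A)} (hS : IsClosed S) (w : List A) (s : ℕ → A) :
    s ∈ infiniteFollower S w ↔ ∀ n, (List.range n).map s ∈ finiteFollower S w := by
  simp only [mem_finiteFollower_iff]
  constructor
  · exact fun hs n => ⟨_, by rwa [wordConcat_map_range_tail]⟩
  · refine fun h => hS.mem_of_forall_prefix fun n => ?_
    obtain ⟨t, ht⟩ := h n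
    refine ⟨_, ht, fun i hi => ?_⟩
    rcases lt_or_ge i w.length with hw | hw
    · rw [wordConcat_apply_of_lt _ _ hw, wordConcat_apply_of_lt _ _ hw]
    · rw [wordConcat_apply_of_le _ _ hw, wordConcat_apply_of_le _ _ hw,
        wordConcat_apply_of_lt _ _ (by simp; omega)]
      simp

theorem wordConcat_singleton_mem_pathSet_iff {A V : Type*} (E : V → A → V → Prop) (u : V) (a : A)
    (s : ℕ → A) : wordConcat [a] s ∈ pathSet E u ↔ ∃ v, E u a v ∧ s ∈ pathSet E v := by
  constructor
  · rintro ⟨p, rfl, hp⟩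
    exact ⟨p 1, by simpa using hp 0, fun n => p (n + 1), rfl, fun n => by simpa using hp (n + 1)⟩
  · rintro ⟨_, hE, p, rfl, hp⟩
    refine ⟨fun n => Nat.casesOn n u p, rfl, fun n => ?_⟩
    cases n with
    | zero => simpa using hE
    | succ n => simpa using hp n

theorem exists_infiniteFollower_eq_iUnion_pathSet {A V : Type*} (E : V → A → V → Prop)
    (T : Set V) (w : List A) :
    ∃ T' : Set V, ⋃ v ∈ T', pathSet E v = infiniteFollower (⋃ v ∈ T, pathSet E v) w := by
  induction w generalizing T with
  | nil => exact ⟨T, by simp⟩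
  | cons a w ih =>
    obtain ⟨T', hT'⟩ := ih {v | ∃ u ∈ T, E u a v}
    refine ⟨T', ?_⟩
    rw [hT', ← List.singleton_append, infiniteFollower_append]
    congr 1
    ext s
    simp only [infiniteFollower, Set.mem_iUnion, Set.mem_ofPred_eq,
      wordConcat_singleton_mem_pathSet_iff, exists_prop]
    tauto

theorem IsOneSidedSofic.finite_infiniteFollower {A : Type*} [Fintype A] {S : Set (ℕ → A)}
    (h : IsOneSidedSofic S) : Set.Finite {F | ∃ w : List A, F = infiniteFollower S w} := by
  obtain ⟨V, _, E, rfl⟩ := h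
  refine (Set.finite_range fun T : Set V => ⋃ v ∈ T, pathSet E v).subset ?_
  rintro _ ⟨w, rfl⟩
  simpa using exists_infiniteFollower_eq_iUnion_pathSet E Set.univ w

/-- In the graph whose vertices are the infinite follower sets of a closed set `S`, each vertex
presents itself. -/
theorem pathSet_infiniteFollower {A : Type*} [TopologicalSpace A] [DiscreteTopology A]
    {S : Set (ℕ → A)} (hS : IsClosed S) (v : {F | ∃ w : List A, F = infiniteFollower S w}) :
    pathSet (fun (F : {F | ∃ w : List A, F = infiniteFollower S w}) a
      (G : {F | ∃ w : List A, F = infiniteFollower S w}) =>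
        G.1 = infiniteFollower F.1 [a] ∧ G.1.Nonempty) v = v.1 := by
  obtain ⟨_, w, rfl⟩ := v
  ext x
  constructor
  · rintro ⟨p, h0, hp⟩
    have hp' : ∀ n, (p n).1 = infiniteFollower S (w ++ (List.range n).map x) := by
      intro n
      induction n with
      | zero => simp [h0]
      | succ n ih =>
        rw [(hp n).1, ih, List.range_succ, List.map_append, ← List.append_assoc,
          infiniteFollower_append S (w ++ _)]
        rfl
    refine hS.mem_of_forall_prefix (x := wordConcat w x) fun n => ?_
    obtain ⟨t, ht⟩ := (hp n).2
    rw [hp', infiniteFollower_append] at ht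
    refine ⟨_, ht, fun i hi => ?_⟩
    rcases lt_or_ge i w.length with hw | hw
    · rw [wordConcat_apply_of_lt _ _ hw, wordConcat_apply_of_lt _ _ hw]
    · rw [wordConcat_apply_of_le _ _ hw, wordConcat_apply_of_le _ _ hw,
        wordConcat_apply_of_lt _ _ (by simp; omega)]
      simp
  · intro hx
    refine ⟨fun n => ⟨_, w ++ (List.range n).map x, rfl⟩, by simp, fun n => ⟨?_, ?_⟩⟩
    · simp only [List.range_succ, List.map_append, ← List.append_assoc]
      exact infiniteFollower_append S _ [x n]
    · refine ⟨fun i => x (i + (n + 1)), ?_⟩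
      change _ ∈ infiniteFollower S (w ++ (List.range (n + 1)).map x)
      rw [infiniteFollower_append]
      change wordConcat _ _ ∈ infiniteFollower S w
      rwa [wordConcat_map_range_tail]

theorem isOneSidedSofic_of_finite_infiniteFollower {A : Type} [Fintype A] [TopologicalSpace A]
    [DiscreteTopology A] {S : Set (ℕ → A)} (hS : IsClosed S) (hinv : shift '' S ⊆ S)
    (h : Set.Finite {F | ∃ w : List A, F = infiniteFollower S w}) : IsOneSidedSofic S := by
  refine ⟨{F | ∃ w : List A, F = infiniteFollower S w}, h.fintype,
    fun F a G => G.1 = infiniteFollower F.1 [a] ∧ G.1.Nonempty, ?_⟩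
  simp only [pathSet_infiniteFollower hS]
  refine Set.Subset.antisymm
    (Set.subset_iUnion_of_subset ⟨S, [], by simp⟩ subset_rfl) (Set.iUnion_subset ?_)
  rintro ⟨_, w, rfl⟩
  exact infiniteFollower_subset hinv w

/-- Characterizations of one-sided sofic shifts: for a closed shift-invariant
`S ⊆ A^ℕ`, the following are equivalent: (1) `S` is a one-sided sofic shift;
(2) `S` has finitely many distinct infinite follower sets; (3) `S` has finitely
many distinct finite follower sets. -/
theorem oneSidedSofic_tfae {A : Type} [Fintype A] [TopologicalSpace A]
    [DiscreteTopology A] (S : Set (ℕ → A)) (hS : IsClosed S)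
    (hinv : shift '' S ⊆ S) :
    List.TFAE [IsOneSidedSofic S,
      Set.Finite {F | ∃ w : List A, F = infiniteFollower S w},
      Set.Finite {F | ∃ w : List A, F = finiteFollower S w}] := by
  tfae_have 1 → 2 := IsOneSidedSofic.finite_infiniteFollower
  tfae_have 2 → 1 := isOneSidedSofic_of_finite_infiniteFollower hS hinv
  tfae_have 2 → 3 := by
    refine fun h => (h.image fun F => {u | ∃ s, wordConcat u s ∈ F}).subset ?_
    rintro _ ⟨w, rfl⟩
    exact ⟨_, ⟨w, rfl⟩, Set.ext fun u => (mem_finiteFollower_iff S w u).symm⟩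
  tfae_have 3 → 2 := by
    refine fun h => (h.image fun K => {s | ∀ n, (List.range n).map s ∈ K}).subset ?_
    rintro _ ⟨w, rfl⟩
    exact ⟨_, ⟨w, rfl⟩,
      Set.ext fun s => (mem_infiniteFollower_iff_forall_prefix hS w s).symm⟩
  tfae_finish
end
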